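/- arXiv:0806.3802 — 2 statements merged into one kernel-verified Lean document; each statement's English description precedes it below -/
import Mathlib

section
/- Let A be the m×n adjacency matrix of a left-d-regular bipartite graph. Let y ∈ ℝᵐ, x ∈ ℝⁿ, let j be a left vertex, let g ∈ ℝ with g ≠ 0, and let T be the set of right vertices i adjacent to j such that y_i − (A·x)_i = g. Let x′ = x + g·e_j, where e_j is the j-th standard basis vector. Then |supp(y − A·x′)| ≤ |supp(y − A·x)| − (2·|T| − d). In particular, if |T| ≥ (1−2ε)·d for some ε ≥ 0, then |supp(y − A·x′)| ≤ |supp(y − A·x)| − (1−4ε)·d. -/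
/-- Gap elimination: let `A` be the adjacency matrix of a left-`d`-regular bipartite graph,
`y ∈ ℝᵐ`, `x ∈ ℝⁿ`, `j` a left vertex, `g ≠ 0`, and let `T` be the set of right vertices `i`
adjacent to `j` with gap `y_i − (Ax)_i = g`.  For `x' = x + g·e_j`,
`|supp(y − Ax')| ≤ |supp(y − Ax)| − (2|T| − d)`; in particular if `|T| ≥ (1−2ε)d` with `ε ≥ 0`
then `|supp(y − Ax')| ≤ |supp(y − Ax)| − (1−4ε)d`. -/
theorem stmt_8 (m n d : ℕ)
    (A : Matrix (Fin m) (Fin n) ℝ)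
    (hA01 : ∀ i j, A i j = 0 ∨ A i j = 1)
    (hreg : ∀ j : Fin n, (Finset.univ.filter fun i => A i j = 1).card = d)
    (y : Fin m → ℝ) (x : Fin n → ℝ) (j : Fin n) (g : ℝ) (hg : g ≠ 0) :
    (((Finset.univ.filter fun i => y i - A.mulVec (x + Pi.single j g) i ≠ 0).card : ℝ)
        ≤ ((Finset.univ.filter fun i => y i - A.mulVec x i ≠ 0).card : ℝ)
          - (2 * ((Finset.univ.filter fun i => A i j = 1 ∧ y i - A.mulVec x i = g).card : ℝ)
              - d)) ∧
      ∀ ε : ℝ, 0 ≤ ε →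
        (1 - 2 * ε) * d
            ≤ ((Finset.univ.filter fun i => A i j = 1 ∧ y i - A.mulVec x i = g).card : ℝ) →
        ((Finset.univ.filter fun i => y i - A.mulVec (x + Pi.single j g) i ≠ 0).card : ℝ)
          ≤ ((Finset.univ.filter fun i => y i - A.mulVec x i ≠ 0).card : ℝ)
            - (1 - 4 * ε) * d := by
  have hgap : ∀ i, y i - A.mulVec (x + Pi.single j g) i
      = y i - A.mulVec x i - A i j * g := by
    intro i
    simp [Matrix.mulVec_add, sub_sub, mul_comm]
  have hcard : (Finset.univ.filter fun i => y i - A.mulVec (x + Pi.single j g) i ≠ 0).card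
      + 2 * (Finset.univ.filter fun i => A i j = 1 ∧ y i - A.mulVec x i = g).card
      ≤ (Finset.univ.filter fun i => y i - A.mulVec x i ≠ 0).card + d := by
    rw [← hreg j]
    simp only [Finset.card_filter, Finset.mul_sum, ← Finset.sum_add_distrib]
    refine Finset.sum_le_sum fun i _ => ?_
    rw [hgap]
    rcases hA01 i j with h | h
    · simp [h]
    · by_cases hi : y i - A.mulVec x i = g
      · simp [h, hi, hg]
      · simp only [h, hi, and_false, if_false, if_true]
        split_ifs <;> omega
  have hreal := (Nat.cast_le (α := ℝ)).mpr hcard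
  push_cast at hreal
  refine ⟨by linarith, fun ε _ hT => by linarith⟩
end

section
/- Let A be the m×n adjacency matrix of a bipartite graph that is left-d-regular and right-D-regular. Let S be a set of k coordinates, λ ≥ 0, and let x ∈ ℝⁿ satisfy |x_j| ≤ λ for all j ∉ S. Set y = A·x and let x_S be the vector agreeing with x on S and zero elsewhere. If v ∈ ℝⁿ is supported on S and minimizes ‖A·w − y‖₂ over all w ∈ ℝⁿ supported on S, then ‖A·v − A·x‖₁ ≤ m·D·λ = n·d·λ. -/
/-- Double counting of the ones of a `0`-`1` matrix with constant column and row counts. -/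
theorem card_mul_eq_card_mul_of_biregular {m n d D : ℕ} (A : Matrix (Fin m) (Fin n) ℝ)
    (hl : ∀ j : Fin n, (Finset.univ.filter fun i => A i j = 1).card = d)
    (hr : ∀ i : Fin m, (Finset.univ.filter fun j => A i j = 1).card = D) :
    m * D = n * d := by
  classical
  have h := Finset.sum_card_bipartiteAbove_eq_sum_card_bipartiteBelow
    (s := Finset.univ) (t := Finset.univ) (fun (i : Fin m) (j : Fin n) => A i j = 1)
  simpa [Finset.bipartiteAbove, Finset.bipartiteBelow, hl, hr] using h

/-- An entry of `A *ᵥ u` is at most `D * lam` in absolute value when the entries of `u` are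
bounded by `lam` and the row of the `0`-`1` matrix `A` has `D` ones. -/
theorem abs_mulVec_le_of_row_card {m n D : ℕ} (A : Matrix (Fin m) (Fin n) ℝ)
    (hA : ∀ i j, A i j = 0 ∨ A i j = 1) (i : Fin m)
    (hr : (Finset.univ.filter fun j => A i j = 1).card = D)
    {lam : ℝ} {u : Fin n → ℝ} (hu : ∀ j, |u j| ≤ lam) :
    |A.mulVec u i| ≤ D * lam := by
  calc |A.mulVec u i| ≤ ∑ j, |A i j * u j| := by
        rw [Matrix.mulVec, dotProduct]
        exact Finset.abs_sum_le_sum_abs _ _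
    _ ≤ ∑ j, if A i j = 1 then lam else 0 := by
        refine Finset.sum_le_sum fun j _ => ?_
        rcases hA i j with h | h <;> simp [h, hu j]
    _ = D * lam := by rw [← Finset.sum_filter, Finset.sum_const, hr, nsmul_eq_mul]

/-- If the sum of squares of `m` reals is at most `m * c ^ 2`, then the sum of their absolute
values is at most `m * c`. -/
theorem sum_abs_le_of_sum_sq_le {m : ℕ} {f : Fin m → ℝ} {c : ℝ} (hc : 0 ≤ c)
    (h : ∑ i, f i ^ 2 ≤ m * c ^ 2) : ∑ i, |f i| ≤ m * c := by
  have hcs := sq_sum_le_card_mul_sum_sq (s := Finset.univ) (f := fun i => |f i|)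
  simp only [sq_abs, Finset.card_univ, Fintype.card_fin] at hcs
  refine abs_le_of_sq_le_sq' ?_ (by positivity) |>.2
  calc (∑ i, |f i|) ^ 2 ≤ m * ∑ i, f i ^ 2 := hcs
    _ ≤ m * (m * c ^ 2) := by gcongr
    _ = (m * c) ^ 2 := by ring

/-- Final recovery bound: if `A` is the adjacency matrix of a left-`d`-regular,
right-`D`-regular bipartite graph, `S` is a set of `k` coordinates, `|x_j| ≤ λ` off `S`,
`y = A·x`, and `v` supported on `S` minimizes `‖A·w − y‖₂` over vectors `w` supported on `S`,
then `‖A·v − A·x‖₁ ≤ m·D·λ = n·d·λ`. -/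
theorem stmt_16 (m n d D k : ℕ)
    (A : Matrix (Fin m) (Fin n) ℝ)
    (hA01 : ∀ i j, A i j = 0 ∨ A i j = 1)
    (hlreg : ∀ j : Fin n, (Finset.univ.filter fun i => A i j = 1).card = d)
    (hrreg : ∀ i : Fin m, (Finset.univ.filter fun j => A i j = 1).card = D)
    (S : Finset (Fin n)) (hS : S.card = k)
    (lam : ℝ) (hlam : 0 ≤ lam)
    (x : Fin n → ℝ) (hx : ∀ j ∉ S, |x j| ≤ lam)
    (y : Fin m → ℝ) (hy : y = A.mulVec x)
    (v : Fin n → ℝ) (hvS : ∀ j ∉ S, v j = 0)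
    (hmin : ∀ w : Fin n → ℝ, (∀ j ∉ S, w j = 0) →
      Real.sqrt (∑ i, (A.mulVec v i - y i) ^ 2)
        ≤ Real.sqrt (∑ i, (A.mulVec w i - y i) ^ 2)) :
    (∑ i, |A.mulVec v i - A.mulVec x i|) ≤ (m : ℝ) * D * lam ∧
      (m : ℝ) * D * lam = (n : ℝ) * d * lam := by
  refine ⟨?_, ?_⟩
  · subst hy
    have hres : ∀ j, |((fun j => if j ∈ S then x j else 0) - x) j| ≤ lam := by
      intro j
      by_cases hj : j ∈ S
      · simpa [hj] using hlam
      · simpa [hj] using hx j hj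
    have hle := hmin (fun j => if j ∈ S then x j else 0) fun j hj => if_neg hj
    rw [Real.sqrt_le_sqrt_iff (Finset.sum_nonneg fun _ _ => sq_nonneg _)] at hle
    rw [mul_assoc]
    refine sum_abs_le_of_sum_sq_le (by positivity) (hle.trans ?_)
    calc _ ≤ ∑ _i : Fin m, ((D : ℝ) * lam) ^ 2 := by
          refine Finset.sum_le_sum fun i _ => ?_
          rw [← Pi.sub_apply, ← Matrix.mulVec_sub, ← sq_abs]
          gcongr
          exact abs_mulVec_le_of_row_card A hA01 i (hrreg i) hres
      _ = m * ((D : ℝ) * lam) ^ 2 := by simp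
  · congr 1
    exact_mod_cast card_mul_eq_card_mul_of_biregular A hlreg hrreg
end
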